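/- Let (P,d) be a finite metric space with doubling constant λ ≥ 1 and |P| = n, and assume n ≥ 2·λ³. Then there exist a point p ∈ P and a real r > 0 such that |B(p,r)| ≥ ⌊n/(2λ³)⌋ and |B(p,2r)| ≤ n/2. -/

import Mathlib

/-- A finite metric space `P` has doubling constant `lam` if for every `x ∈ P` and `r > 0`
there are at most `lam` points whose closed balls of radius `r/2` cover the closed ball
`B(x,r)`. -/
def IsDoubling (P : Type*) [MetricSpace P] (lam : ℝ) : Prop :=
  ∀ (x : P) (r : ℝ), 0 < r → ∃ s : Finset P, (s.card : ℝ) ≤ lam ∧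
    ∀ y : P, dist x y ≤ r → ∃ z ∈ s, dist z y ≤ r / 2

theorem IsDoubling.card_closedBall_le {P : Type*} [MetricSpace P] [Fintype P] {lam : ℝ}
    (hdbl : IsDoubling P lam) {r M : ℝ} (hr : 0 < r) (hM : 0 ≤ M)
    (h : ∀ z : P, ((Finset.univ.filter (fun y => dist z y ≤ r / 2)).card : ℝ) ≤ M) (x : P) :
    ((Finset.univ.filter (fun y => dist x y ≤ r)).card : ℝ) ≤ lam * M := by
  classical
  obtain ⟨s, hs, hcov⟩ := hdbl x r hr
  have hsub : Finset.univ.filter (fun y => dist x y ≤ r) ⊆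
      s.biUnion (fun z => Finset.univ.filter (fun y => dist z y ≤ r / 2)) := by
    intro y hy
    simpa using hcov y (by simpa using hy)
  calc ((Finset.univ.filter (fun y => dist x y ≤ r)).card : ℝ)
      ≤ ((∑ z ∈ s, (Finset.univ.filter (fun y => dist z y ≤ r / 2)).card : ℕ) : ℝ) := by
        exact_mod_cast (Finset.card_le_card hsub).trans Finset.card_biUnion_le
    _ = ∑ z ∈ s, ((Finset.univ.filter (fun y => dist z y ≤ r / 2)).card : ℝ) := by
        push_cast; rfl
    _ ≤ ∑ _z ∈ s, M := Finset.sum_le_sum fun z _ => h z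
    _ = s.card * M := by simp
    _ ≤ lam * M := by gcongr

/-- In a nontrivial finite metric space, all balls of some positive radius are singletons. -/
theorem exists_pos_forall_dist_le_imp_eq (P : Type*) [MetricSpace P] [Fintype P] [Nontrivial P] :
    ∃ r : ℝ, 0 < r ∧ ∀ x y : P, dist x y ≤ r → x = y := by
  classical
  obtain ⟨a, b, hab⟩ := exists_pair_ne P
  obtain ⟨q, hq, hmin⟩ := Finset.exists_min_image (Finset.univ : Finset P).offDiag
    (fun q => dist q.1 q.2) ⟨(a, b), by simpa using hab⟩
  have hpos : 0 < dist q.1 q.2 := dist_pos.2 (by simpa using hq)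
  refine ⟨dist q.1 q.2 / 2, by linarith, fun x y hxy => ?_⟩
  by_contra hne
  have := hmin (x, y) (by simpa using hne)
  simp only at this
  linarith

/-- Some closed ball with at least `m` points has minimal radius among all such balls. -/
theorem exists_minimal_closedBall {P : Type*} [MetricSpace P] [Fintype P] [Nonempty P] {m : ℕ}
    (hm : 0 < m) (hmP : m ≤ Fintype.card P) :
    ∃ (p : P) (r : ℝ), m ≤ (Finset.univ.filter (fun y => dist p y ≤ r)).card ∧
      ∀ (x : P) (t : ℝ), t < r → (Finset.univ.filter (fun y => dist x y ≤ t)).card < m := by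
  classical
  have key : ∀ (x : P) (t : ℝ), m ≤ (Finset.univ.filter (fun y => dist x y ≤ t)).card →
      ∃ q : P, dist x q ≤ t ∧
        m ≤ (Finset.univ.filter (fun y => dist x y ≤ dist x q)).card := by
    intro x t h
    obtain ⟨q, hq, hmax⟩ := Finset.exists_max_image
      (Finset.univ.filter (fun y => dist x y ≤ t)) (fun y => dist x y)
      (Finset.card_pos.1 (hm.trans_le h))
    refine ⟨q, by simpa using hq, h.trans (Finset.card_le_card fun y hy => ?_)⟩
    simpa using hmax y hy
  obtain ⟨a⟩ := ‹Nonempty P›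
  obtain ⟨b, -, hb⟩ := Finset.exists_max_image (Finset.univ : Finset P) (fun y => dist a y)
    ⟨a, Finset.mem_univ a⟩
  have hab : m ≤ (Finset.univ.filter (fun y => dist a y ≤ dist a b)).card := by
    rwa [Finset.filter_true_of_mem hb, Finset.card_univ]
  obtain ⟨c, hc, hmin⟩ := Finset.exists_min_image
    (Finset.univ.filter fun c : P × P =>
      m ≤ (Finset.univ.filter (fun y => dist c.1 y ≤ dist c.1 c.2)).card)
    (fun c => dist c.1 c.2) ⟨(a, b), by simpa using hab⟩
  refine ⟨c.1, dist c.1 c.2, by simpa using hc, fun x t ht => ?_⟩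
  by_contra! h
  obtain ⟨q, hqt, hq⟩ := key x t h
  have := hmin (x, q) (by simpa using hq)
  simp only at this
  linarith

theorem stmt1 {P : Type*} [MetricSpace P] [Fintype P]
    (lam : ℝ) (hlam : 1 ≤ lam) (hdbl : IsDoubling P lam)
    (hn : 2 * lam ^ 3 ≤ (Fintype.card P : ℝ)) :
    ∃ (p : P) (r : ℝ), 0 < r ∧
      ⌊(Fintype.card P : ℝ) / (2 * lam ^ 3)⌋₊ ≤
        (Finset.univ.filter (fun y => dist p y ≤ r)).card ∧
      ((Finset.univ.filter (fun y => dist p y ≤ 2 * r)).card : ℝ) ≤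
        (Fintype.card P : ℝ) / 2 := by
  have hlam3 : 1 ≤ lam ^ 3 := one_le_pow₀ hlam
  have hcard : (2 : ℝ) ≤ Fintype.card P := by linarith
  have : Nontrivial P := Fintype.one_lt_card_iff_nontrivial.1 (by
    have : 2 ≤ Fintype.card P := by exact_mod_cast hcard
    omega)
  have hfloor : (⌊(Fintype.card P : ℝ) / (2 * lam ^ 3)⌋₊ : ℝ) ≤
      (Fintype.card P : ℝ) / (2 * lam ^ 3) := Nat.floor_le (by positivity)
  have hpos : 0 < ⌊(Fintype.card P : ℝ) / (2 * lam ^ 3)⌋₊ :=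
    Nat.floor_pos.2 ((one_le_div (by positivity)).2 hn)
  generalize ⌊(Fintype.card P : ℝ) / (2 * lam ^ 3)⌋₊ = m at hfloor hpos ⊢
  rw [le_div_iff₀ (by positivity)] at hfloor
  have hmP : m ≤ Fintype.card P := by
    have : (m : ℝ) ≤ Fintype.card P := by nlinarith [(Nat.cast_nonneg m : (0 : ℝ) ≤ m)]
    exact_mod_cast this
  obtain ⟨p, r, hpr, hmin⟩ := exists_minimal_closedBall hpos hmP
  rcases lt_or_ge 0 r with hr | hr
  · refine ⟨p, r, hr, hpr, ?_⟩
    have hsmall : ∀ z : P,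
        ((Finset.univ.filter (fun y => dist z y ≤ r / 2)).card : ℝ) ≤ m := fun z => by
      exact_mod_cast (hmin z (r / 2) (by linarith)).le
    have hmid := hdbl.card_closedBall_le hr (Nat.cast_nonneg m) hsmall
    have hlarge := hdbl.card_closedBall_le (r := 2 * r) (by linarith)
      (M := lam * m) (by positivity) (by simpa using hmid) p
    have hmono : lam ^ 2 * m ≤ lam ^ 3 * m := by gcongr <;> norm_num
    linarith
  · obtain ⟨t, ht, hsep⟩ := exists_pos_forall_dist_le_imp_eq P
    refine ⟨p, t / 2, by linarith, hpr.trans (Finset.card_le_card fun y hy => ?_), ?_⟩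
    · simp only [Finset.mem_filter, Finset.mem_univ, true_and] at hy ⊢
      linarith
    · have hone : (Finset.univ.filter (fun y => dist p y ≤ 2 * (t / 2))).card ≤ 1 := by
        refine Finset.card_le_one_iff_subset_singleton.2 ⟨p, fun y hy => ?_⟩
        simp only [Finset.mem_filter, Finset.mem_univ, true_and] at hy
        simpa using (hsep p y (by linarith)).symm
      have : ((Finset.univ.filter (fun y => dist p y ≤ 2 * (t / 2))).card : ℝ) ≤ 1 := by
        exact_mod_cast hone
      linarith
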